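/- arXiv:2105.02113 — 8 statements merged into one kernel-verified Lean document; each statement's English description precedes it below -/
import Mathlib

section
/- Let m, R, g > 0 and α ∈ ℝ. Suppose twice-differentiable functions x, y, φ, θ : ℝ → ℝ together with functions λ1, λ2 : ℝ → ℝ satisfy both rolling constraints and all four nonholonomic equations of motion. Then φ satisfies the reduced second-order equation φ''(t) = (2 g sin α / (3 R)) cos θ(t) for all t. -/
open Real

/-- For the rolling coin on an inclined plane: any solution of the rolling
constraints together with the four nonholonomic equations of motion satisfies
the reduced equation `φ'' = (2 g sin α / (3R)) cos θ`. -/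
theorem rolling_coin_reduced_phi_equation
    (m R g α : ℝ) (hm : 0 < m) (hR : 0 < R) (hg : 0 < g)
    (x y φ θ : ℝ → ℝ) (lam1 lam2 : ℝ → ℝ)
    (hx : Differentiable ℝ x) (hx' : Differentiable ℝ (deriv x))
    (hy : Differentiable ℝ y) (hy' : Differentiable ℝ (deriv y))
    (hφ : Differentiable ℝ φ) (hφ' : Differentiable ℝ (deriv φ))
    (hθ : Differentiable ℝ θ) (hθ' : Differentiable ℝ (deriv θ))
    (hcon1 : ∀ t, deriv x t = R * deriv φ t * Real.sin (θ t))
    (hcon2 : ∀ t, deriv y t = R * deriv φ t * Real.cos (θ t))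
    (heq1 : ∀ t, m * deriv (deriv x) t = lam1 t)
    (heq2 : ∀ t, m * deriv (deriv y) t = m * g * Real.sin α + lam2 t)
    (heq3 : ∀ t, m * R ^ 2 / 2 * deriv (deriv φ) t
      = -(lam1 t) * R * Real.sin (θ t) - lam2 t * R * Real.cos (θ t))
    (heq4 : ∀ t, m * R ^ 2 / 4 * deriv (deriv θ) t = 0) :
    ∀ t, deriv (deriv φ) t = 2 * g * Real.sin α / (3 * R) * Real.cos (θ t) := by
  intro t
  have hφt := (hφ' t).hasDerivAt
  have hθt := (hθ t).hasDerivAt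
  have hX : deriv (deriv x) t
      = R * deriv (deriv φ) t * Real.sin (θ t)
        + R * deriv φ t * (Real.cos (θ t) * deriv θ t) := by
    rw [funext hcon1]
    exact ((hφt.const_mul R).mul hθt.sin).deriv
  have hY : deriv (deriv y) t
      = R * deriv (deriv φ) t * Real.cos (θ t)
        + R * deriv φ t * (-Real.sin (θ t) * deriv θ t) := by
    rw [funext hcon2]
    exact ((hφt.const_mul R).mul hθt.cos).deriv
  have h1 := heq1 t
  have h2 := heq2 t
  rw [hX] at h1
  rw [hY] at h2
  have key : m * R * (deriv (deriv φ) t * (3 * R))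
      = m * R * (2 * g * Real.sin α * Real.cos (θ t)) := by
    linear_combination 2 * heq3 t + 2 * R * Real.sin (θ t) * h1
      + 2 * R * Real.cos (θ t) * h2
      - 2 * m * R ^ 2 * deriv (deriv φ) t * Real.sin_sq_add_cos_sq (θ t)
  rw [div_mul_eq_mul_div, eq_div_iff (by positivity)]
  exact mul_left_cancel₀ (by positivity) key
end

section
/- Let m, R, g > 0 and α ∈ ℝ. Suppose twice-differentiable functions x, y, φ, θ : ℝ → ℝ together with functions λ1, λ2 : ℝ → ℝ satisfy both rolling constraints and all four nonholonomic equations of motion, and suppose θ'(0) = Ω with Ω ≠ 0. Then there exist constants x0, y0, θ0, φ0, ω such that x, y, φ, θ are given by the explicit nonholonomic solution formulas for all t. -/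
open Real

/-- Two real functions with the same derivative differ by their difference at `0`. -/
theorem eq_add_const_of_hasDerivAt {f h f' : ℝ → ℝ}
    (hf : ∀ t, HasDerivAt f (f' t) t) (hh : ∀ t, HasDerivAt h (f' t) t) (t : ℝ) :
    f t = h t + (f 0 - h 0) := by
  have hd : ∀ t, HasDerivAt (fun s => f s - h s) 0 t := fun t =>
    ((hf t).sub (hh t)).congr_deriv (sub_self _)
  have := is_const_of_deriv_eq_zero (fun t => (hd t).differentiableAt)
    (fun t => (hd t).deriv) t 0
  linarith

/-- Every solution of the rolling constraints and the four nonholonomic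
equations of motion of the rolling coin on an inclined plane with
`θ'(0) = Ω ≠ 0` is given by the explicit solution formulas for suitable
constants `x0, y0, θ0, φ0, ω`. -/
theorem rolling_coin_nonholonomic_general_solution
    (m R g α Ω : ℝ) (hm : 0 < m) (hR : 0 < R) (hg : 0 < g) (hΩ : Ω ≠ 0)
    (x y φ θ : ℝ → ℝ) (lam1 lam2 : ℝ → ℝ)
    (hx : Differentiable ℝ x) (hx' : Differentiable ℝ (deriv x))
    (hy : Differentiable ℝ y) (hy' : Differentiable ℝ (deriv y))
    (hφ : Differentiable ℝ φ) (hφ' : Differentiable ℝ (deriv φ))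
    (hθ : Differentiable ℝ θ) (hθ' : Differentiable ℝ (deriv θ))
    (hcon1 : ∀ t, deriv x t = R * deriv φ t * Real.sin (θ t))
    (hcon2 : ∀ t, deriv y t = R * deriv φ t * Real.cos (θ t))
    (heq1 : ∀ t, m * deriv (deriv x) t = lam1 t)
    (heq2 : ∀ t, m * deriv (deriv y) t = m * g * Real.sin α + lam2 t)
    (heq3 : ∀ t, m * R ^ 2 / 2 * deriv (deriv φ) t
      = -(lam1 t) * R * Real.sin (θ t) - lam2 t * R * Real.cos (θ t))
    (heq4 : ∀ t, m * R ^ 2 / 4 * deriv (deriv θ) t = 0)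
    (hθ0 : deriv θ 0 = Ω) :
    ∃ x0 y0 θ0 φ0 ω : ℝ, ∀ t,
      θ t = Ω * t + θ0 ∧
      φ t = φ0 + ω * t
        - 2 * g * Real.sin α / (3 * Ω ^ 2 * R) * Real.cos (Ω * t + θ0) ∧
      x t = x0 + g * Real.sin α / (3 * Ω) * t
        - (ω * R / Ω + g * Real.sin α / (3 * Ω ^ 2) * Real.sin (Ω * t + θ0))
          * Real.cos (Ω * t + θ0) ∧
      y t = y0
        + (ω * R / Ω + g * Real.sin α / (3 * Ω ^ 2) * Real.sin (Ω * t + θ0))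
          * Real.sin (Ω * t + θ0) := by
  have hdθ (t : ℝ) : deriv θ t = Ω := by
    have h0 (t : ℝ) : deriv (deriv θ) t = 0 :=
      (mul_eq_zero.mp (heq4 t)).resolve_left (by positivity)
    exact (is_const_of_deriv_eq_zero hθ' h0 t 0).trans hθ0
  have hθD (t : ℝ) : HasDerivAt θ Ω t := hdθ t ▸ (hθ t).hasDerivAt
  obtain ⟨θ0, hθe⟩ : ∃ θ0, ∀ t, θ t = Ω * t + θ0 :=
    ⟨_, eq_add_const_of_hasDerivAt hθD fun t => by
      simpa using (hasDerivAt_id t).const_mul Ω⟩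
  have hlin (t : ℝ) : HasDerivAt (fun s => Ω * s + θ0) Ω t := by
    simpa using ((hasDerivAt_id t).const_mul Ω).add_const θ0
  have hsin (t : ℝ) := (hlin t).sin
  have hcos (t : ℝ) := (hlin t).cos
  have hddx (t : ℝ) : deriv (deriv x) t
      = R * deriv (deriv φ) t * sin (θ t) + R * deriv φ t * (cos (θ t) * Ω) := by
    rw [funext hcon1]
    exact (((hφ' t).hasDerivAt.const_mul R).mul (hθD t).sin).deriv
  have hddy (t : ℝ) : deriv (deriv y) t
      = R * deriv (deriv φ) t * cos (θ t) + R * deriv φ t * (-sin (θ t) * Ω) := by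
    rw [funext hcon2]
    exact (((hφ' t).hasDerivAt.const_mul R).mul (hθD t).cos).deriv
  have hddφ (t : ℝ) :
      deriv (deriv φ) t = 2 * g * sin α / (3 * R) * cos (Ω * t + θ0) := by
    have h3 := heq3 t
    have h2 := heq2 t
    rw [← heq1 t, hddx] at h3
    rw [hddy] at h2
    rw [← hθe]
    have hmR : m * R ≠ 0 := by positivity
    have key : m * R * (3 * R * deriv (deriv φ) t)
        = m * R * (2 * g * sin α * cos (θ t)) := by
      linear_combination 2 * h3 + 2 * R * cos (θ t) * h2
        - 2 * m * R ^ 2 * deriv (deriv φ) t * sin_sq_add_cos_sq (θ t)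
    have := mul_left_cancel₀ hmR key
    field_simp
    linarith
  obtain ⟨ω, hdφ⟩ : ∃ ω, ∀ t,
      deriv φ t = 2 * g * sin α / (3 * R * Ω) * sin (Ω * t + θ0) + ω := by
    refine ⟨_, eq_add_const_of_hasDerivAt (fun t => (hφ' t).hasDerivAt) fun t => ?_⟩
    refine HasDerivAt.congr_deriv ((hsin t).const_mul (2 * g * sin α / (3 * R * Ω))) ?_
    rw [hddφ]
    field_simp
  obtain ⟨φ0, hφe⟩ : ∃ φ0, ∀ t, φ t = ω * t
      - 2 * g * sin α / (3 * Ω ^ 2 * R) * cos (Ω * t + θ0) + φ0 := by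
    refine ⟨_, eq_add_const_of_hasDerivAt (fun t => (hφ t).hasDerivAt) fun t => ?_⟩
    refine HasDerivAt.congr_deriv (((hasDerivAt_id t).const_mul ω).sub
      ((hcos t).const_mul (2 * g * sin α / (3 * Ω ^ 2 * R)))) ?_
    rw [hdφ]
    field_simp
    ring
  have hamp (t : ℝ) :=
    ((hsin t).const_mul (g * sin α / (3 * Ω ^ 2))).const_add (ω * R / Ω)
  obtain ⟨x0, hxe⟩ : ∃ x0, ∀ t, x t = g * sin α / (3 * Ω) * t
      - (ω * R / Ω + g * sin α / (3 * Ω ^ 2) * sin (Ω * t + θ0))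
        * cos (Ω * t + θ0) + x0 := by
    refine ⟨_, eq_add_const_of_hasDerivAt (fun t => (hx t).hasDerivAt) fun t => ?_⟩
    refine HasDerivAt.congr_deriv (((hasDerivAt_id t).const_mul (g * sin α / (3 * Ω))).sub
      ((hamp t).mul (hcos t))) ?_
    rw [hcon1, hdφ, hθe]
    field_simp
    linear_combination -g * sin α * sin_sq_add_cos_sq (Ω * t + θ0)
  obtain ⟨y0, hye⟩ : ∃ y0, ∀ t, y t =
      (ω * R / Ω + g * sin α / (3 * Ω ^ 2) * sin (Ω * t + θ0))
        * sin (Ω * t + θ0) + y0 := by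
    refine ⟨_, eq_add_const_of_hasDerivAt (fun t => (hy t).hasDerivAt) fun t => ?_⟩
    refine HasDerivAt.congr_deriv ((hamp t).mul (hsin t)) ?_
    rw [hcon2, hdφ, hθe]
    field_simp
    ring
  refine ⟨x0, y0, θ0, φ0, ω, fun t => ⟨hθe t, ?_, ?_, ?_⟩⟩
  · rw [hφe]; ring
  · rw [hxe]; ring
  · rw [hye]; ring
end

section
/- Let m, R, g > 0, α ∈ ℝ, and Ω ≠ 0. Define x(t) = (g sin α / (3 Ω²)) (Ω t − 2 sin(Ω t) + sin(Ω t) cos(Ω t)), y(t) = (g sin α / (3 Ω²)) (1 − cos(Ω t))², θ(t) = Ω t + π/2, and φ(t) = −(2 g sin α / (3 Ω R)) t + (2 g sin α / (3 Ω² R)) sin(Ω t), and define λ1(t) = m R φ''(t) sin θ(t) + m R Ω φ'(t) cos θ(t) and λ2(t) = m R φ''(t) cos θ(t) − m R Ω φ'(t) sin θ(t) − m g sin α. Then (x, y, φ, θ, λ1, λ2) satisfy both rolling constraints and all four nonholonomic equations of motion, and the initial conditions x(0) = 0, x'(0) = 0, y(0) = 0, y'(0) = 0, φ(0) = 0, φ'(0)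 = 0, θ(0) = π/2, θ'(0) = Ω hold. -/
open Real

/-- The explicit motion of the rolling coin on an inclined plane associated
with the initial conditions `x(0) = x'(0) = y(0) = y'(0) = φ(0) = φ'(0) = 0`,
`θ(0) = π/2`, `θ'(0) = Ω` satisfies (together with the indicated Lagrange
multipliers) both rolling constraints, all four nonholonomic equations of
motion, and those initial conditions. -/
theorem rolling_coin_special_solution
    (m R g α Ω : ℝ) (hm : 0 < m) (hR : 0 < R) (hg : 0 < g) (hΩ : Ω ≠ 0)
    (x y φ θ : ℝ → ℝ) (lam1 lam2 : ℝ → ℝ)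
    (hx : ∀ t, x t = g * Real.sin α / (3 * Ω ^ 2)
      * (Ω * t - 2 * Real.sin (Ω * t) + Real.sin (Ω * t) * Real.cos (Ω * t)))
    (hy : ∀ t, y t = g * Real.sin α / (3 * Ω ^ 2) * (1 - Real.cos (Ω * t)) ^ 2)
    (hθ : ∀ t, θ t = Ω * t + π / 2)
    (hφ : ∀ t, φ t = -(2 * g * Real.sin α / (3 * Ω * R)) * t
      + 2 * g * Real.sin α / (3 * Ω ^ 2 * R) * Real.sin (Ω * t))
    (hlam1 : ∀ t, lam1 t = m * R * deriv (deriv φ) t * Real.sin (θ t)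
      + m * R * Ω * deriv φ t * Real.cos (θ t))
    (hlam2 : ∀ t, lam2 t = m * R * deriv (deriv φ) t * Real.cos (θ t)
      - m * R * Ω * deriv φ t * Real.sin (θ t) - m * g * Real.sin α) :
    (∀ t, deriv x t = R * deriv φ t * Real.sin (θ t)) ∧
    (∀ t, deriv y t = R * deriv φ t * Real.cos (θ t)) ∧
    (∀ t, m * deriv (deriv x) t = lam1 t) ∧
    (∀ t, m * deriv (deriv y) t = m * g * Real.sin α + lam2 t) ∧
    (∀ t, m * R ^ 2 / 2 * deriv (deriv φ) t
      = -(lam1 t) * R * Real.sin (θ t) - lam2 t * R * Real.cos (θ t)) ∧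
    (∀ t, m * R ^ 2 / 4 * deriv (deriv θ) t = 0) ∧
    x 0 = 0 ∧ deriv x 0 = 0 ∧ y 0 = 0 ∧ deriv y 0 = 0 ∧
    φ 0 = 0 ∧ deriv φ 0 = 0 ∧ θ 0 = π / 2 ∧ deriv θ 0 = Ω := by
  have hs : ∀ t, HasDerivAt (fun t => Real.sin (Ω * t)) (Ω * Real.cos (Ω * t)) t := fun t => by
    simpa [mul_comm] using ((hasDerivAt_id t).const_mul Ω).sin
  have hc : ∀ t, HasDerivAt (fun t => Real.cos (Ω * t)) (-(Ω * Real.sin (Ω * t))) t := fun t => by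
    simpa [mul_comm] using ((hasDerivAt_id t).const_mul Ω).cos
  have hR' : R ≠ 0 := hR.ne'
  have hsinθ : ∀ t, Real.sin (θ t) = Real.cos (Ω * t) := fun t => by
    rw [hθ, Real.sin_add_pi_div_two]
  have hcosθ : ∀ t, Real.cos (θ t) = -Real.sin (Ω * t) := fun t => by
    rw [hθ, Real.cos_add_pi_div_two]
  have dφ : deriv φ = fun t => 2 * g * Real.sin α / (3 * Ω * R) * (Real.cos (Ω * t) - 1) := by
    funext t
    rw [funext hφ]
    refine ((((hasDerivAt_id t).const_mul _).add ((hs t).const_mul _)).congr_deriv ?_).deriv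
    field_simp
    ring
  have ddφ : deriv (deriv φ) = fun t => -(2 * g * Real.sin α / (3 * R) * Real.sin (Ω * t)) := by
    funext t
    rw [dφ]
    refine ((((hc t).sub_const 1).const_mul _).congr_deriv ?_).deriv
    field_simp
  have dx : deriv x = fun t => R * deriv φ t * Real.cos (Ω * t) := by
    funext t
    rw [funext hx, dφ]
    refine ((((((hasDerivAt_id t).const_mul Ω).sub ((hs t).const_mul 2)).add
      ((hs t).mul (hc t))).const_mul _).congr_deriv ?_).deriv
    field_simp
    linear_combination (-Real.sin α) * Real.sin_sq_add_cos_sq (Ω * t)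
  have dy : deriv y = fun t => -(R * deriv φ t * Real.sin (Ω * t)) := by
    funext t
    rw [funext hy, dφ]
    refine (((((hc t).const_sub 1).pow 2).const_mul _).congr_deriv ?_).deriv
    field_simp
    ring
  have dθ : deriv θ = fun _ => Ω := by
    funext t
    rw [funext hθ]
    simp
  have hφ' : ∀ t, HasDerivAt (deriv φ) (deriv (deriv φ) t) t := fun t => by
    refine DifferentiableAt.hasDerivAt ?_
    rw [dφ]
    fun_prop
  have ddx : ∀ t, deriv (deriv x) t = R * deriv (deriv φ) t * Real.cos (Ω * t)
      - R * Ω * deriv φ t * Real.sin (Ω * t) := fun t => by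
    rw [dx]
    refine ((((hφ' t).const_mul R).mul (hc t)).congr_deriv ?_).deriv
    ring
  have ddy : ∀ t, deriv (deriv y) t = -(R * deriv (deriv φ) t * Real.sin (Ω * t))
      - R * Ω * deriv φ t * Real.cos (Ω * t) := fun t => by
    rw [dy]
    refine (((((hφ' t).const_mul R).mul (hs t)).neg).congr_deriv ?_).deriv
    ring
  refine ⟨fun t => ?_, fun t => ?_, fun t => ?_, fun t => ?_, fun t => ?_, fun t => ?_,
    ?_, ?_, ?_, ?_, ?_, ?_, ?_, ?_⟩
  · rw [dx, hsinθ]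
  · rw [dy, hcosθ]
    ring
  · rw [ddx, hlam1, hsinθ, hcosθ]
    ring
  · rw [ddy, hlam2, hsinθ, hcosθ]
    ring
  · have hacc : R * deriv (deriv φ) t = -(2 / 3 * (g * Real.sin α) * Real.sin (Ω * t)) := by
      rw [ddφ]
      field_simp
    rw [hlam1, hlam2, hsinθ, hcosθ]
    linear_combination (3 / 2 * m * R) * hacc
      + (m * R ^ 2 * deriv (deriv φ) t) * Real.sin_sq_add_cos_sq (Ω * t)
  · simp [dθ]
  · simp [hx]
  · simp [dx, dφ]
  · simp [hy]
  · simp [dy]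
  · simp [hφ]
  · simp [dφ]
  · simp [hθ]
  · simp [dθ]
end

section
/- Let m, R, g > 0 and α ∈ ℝ. Suppose x, y, φ, θ : ℝ → ℝ are twice differentiable with θ''(t) = 0 for all t, that the rolling constraints hold, and that differentiable functions λ1, λ2 : ℝ → ℝ satisfy the first, second and fourth vakonomic equations: m x'' = −λ1', m y'' = m g sin α − λ2', and (m R²/4) θ'' = −λ1 R φ' cos θ + λ2 R φ' sin θ. Then for all t, (λ1(0) + m x'(0)) y'(t) = (λ2(0) + m y'(0) + m g t sin α) x'(t). -/
open Real

/-- For the rolling coin on an inclined plane: if `θ'' = 0`, the rolling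
constraints hold, and the first, second and fourth vakonomic equations of
motion hold, then for all `t`,
`(λ₁(0) + m x'(0)) y'(t) = (λ₂(0) + m y'(0) + m g t sin α) x'(t)`. -/
theorem rolling_coin_vakonomic_key_relation
    (m R g α : ℝ) (hm : 0 < m) (hR : 0 < R) (hg : 0 < g)
    (x y φ θ : ℝ → ℝ) (lam1 lam2 : ℝ → ℝ)
    (hx : Differentiable ℝ x) (hx' : Differentiable ℝ (deriv x))
    (hy : Differentiable ℝ y) (hy' : Differentiable ℝ (deriv y))
    (hφ : Differentiable ℝ φ) (hφ' : Differentiable ℝ (deriv φ))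
    (hθ : Differentiable ℝ θ) (hθ' : Differentiable ℝ (deriv θ))
    (hθ'' : ∀ t, deriv (deriv θ) t = 0)
    (hcon1 : ∀ t, deriv x t = R * deriv φ t * Real.sin (θ t))
    (hcon2 : ∀ t, deriv y t = R * deriv φ t * Real.cos (θ t))
    (hlam1 : Differentiable ℝ lam1) (hlam2 : Differentiable ℝ lam2)
    (heq1 : ∀ t, m * deriv (deriv x) t = -(deriv lam1 t))
    (heq2 : ∀ t, m * deriv (deriv y) t = m * g * Real.sin α - deriv lam2 t)
    (heq4 : ∀ t, m * R ^ 2 / 4 * deriv (deriv θ) t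
      = -(lam1 t) * R * deriv φ t * Real.cos (θ t)
        + lam2 t * R * deriv φ t * Real.sin (θ t)) :
    ∀ t, (lam1 0 + m * deriv x 0) * deriv y t
      = (lam2 0 + m * deriv y 0 + m * g * Real.sin α * t) * deriv x t := by
  intro t
  have h1 : lam1 t + m * deriv x t = lam1 0 + m * deriv x 0 := by
    refine is_const_of_deriv_eq_zero (f := fun s => lam1 s + m * deriv x s)
      (hlam1.add (hx'.const_mul m)) (fun s => ?_) t 0
    have h := ((hlam1 s).hasDerivAt.add ((hx' s).hasDerivAt.const_mul m)).deriv
    exact h.trans (by linarith [heq1 s])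
  have h2 : lam2 t + m * deriv y t - m * g * Real.sin α * t = lam2 0 + m * deriv y 0 := by
    have hd : ∀ s, HasDerivAt (fun s => lam2 s + m * deriv y s - m * g * Real.sin α * s)
        (deriv lam2 s + m * deriv (deriv y) s - m * g * Real.sin α * 1) s := fun s =>
      ((hlam2 s).hasDerivAt.add ((hy' s).hasDerivAt.const_mul m)).sub
        ((hasDerivAt_id s).const_mul (m * g * Real.sin α))
    have h := is_const_of_deriv_eq_zero (fun s => (hd s).differentiableAt)
      (fun s => (hd s).deriv.trans (by linarith [heq2 s])) t 0
    simpa using h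
  have h4 : lam1 t * deriv y t = lam2 t * deriv x t := by
    have h := heq4 t
    rw [hθ'' t] at h
    rw [hcon1, hcon2]
    linarith
  linear_combination h4 - deriv y t * h1 + deriv x t * h2
end

section
/- (Main theorem, explicit form.) Let m, R, g > 0, 0 < α < π/2, and let x0, y0, θ0, φ0, ω, Ω be constants with Ω ≠ 0, and let x, y, φ, θ be the explicit nonholonomic solution. Then there exist NO differentiable functions λ1, λ2 : ℝ → ℝ such that all four vakonomic equations of motion hold for all t. In other words, no nontrivial nonholonomic motion of the rolling coin on the inclined plane is a vakonomic motion, for any choice of the initial values λ1(0), λ2(0) of the Lagrange multipliers. -/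
open Real

/-- Main theorem (explicit form): for the rolling coin on an inclined plane
with `0 < α < π/2`, no nontrivial (`Ω ≠ 0`) explicit nonholonomic motion can
be produced by vakonomic mechanics: there are no differentiable Lagrange
multipliers `λ₁, λ₂` for which the four vakonomic equations of motion hold
along that motion, whatever the initial values `λ₁(0), λ₂(0)`. -/
theorem rolling_coin_nonholonomic_motion_is_not_vakonomic
    (m R g α x0 y0 θ0 φ0 ω Ω : ℝ)
    (hm : 0 < m) (hR : 0 < R) (hg : 0 < g)
    (hα1 : 0 < α) (hα2 : α < π / 2) (hΩ : Ω ≠ 0)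
    (x y φ θ : ℝ → ℝ)
    (hθ : ∀ t, θ t = Ω * t + θ0)
    (hφ : ∀ t, φ t = φ0 + ω * t
      - 2 * g * Real.sin α / (3 * Ω ^ 2 * R) * Real.cos (Ω * t + θ0))
    (hx : ∀ t, x t = x0 + g * Real.sin α / (3 * Ω) * t
      - (ω * R / Ω + g * Real.sin α / (3 * Ω ^ 2) * Real.sin (Ω * t + θ0))
        * Real.cos (Ω * t + θ0))
    (hy : ∀ t, y t = y0
      + (ω * R / Ω + g * Real.sin α / (3 * Ω ^ 2) * Real.sin (Ω * t + θ0))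
        * Real.sin (Ω * t + θ0)) :
    ¬ ∃ lam1 lam2 : ℝ → ℝ,
      Differentiable ℝ lam1 ∧ Differentiable ℝ lam2 ∧
      (∀ t, m * deriv (deriv x) t = -(deriv lam1 t)) ∧
      (∀ t, m * deriv (deriv y) t = m * g * Real.sin α - deriv lam2 t) ∧
      (∀ t, m * R ^ 2 / 2 * deriv (deriv φ) t
        = lam1 t * R * deriv θ t * Real.cos (θ t)
          - lam2 t * R * deriv θ t * Real.sin (θ t)
          + deriv lam1 t * R * Real.sin (θ t)
          + deriv lam2 t * R * Real.cos (θ t)) ∧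
      (∀ t, m * R ^ 2 / 4 * deriv (deriv θ) t
        = -(lam1 t) * R * deriv φ t * Real.cos (θ t)
          + lam2 t * R * deriv φ t * Real.sin (θ t)) := by
  rintro ⟨lam1, lam2, -, hlam2, -, hyEq, -, hθEq⟩
  have hsin : 0 < sin α := sin_pos_of_pos_of_lt_pi hα1 (by linarith [pi_pos])
  have hu : ∀ t, HasDerivAt (fun t => Ω * t + θ0) Ω t := fun t => by
    simpa using ((hasDerivAt_id t).const_mul Ω).add_const θ0
  have hdθ : deriv θ = fun _ => Ω := by
    rw [funext hθ]
    exact funext fun t => (hu t).deriv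
  have hdφ : ∀ t, deriv φ t = ω + 2 * g * sin α / (3 * Ω * R) * sin (Ω * t + θ0) := by
    intro t
    rw [funext hφ]
    refine HasDerivAt.deriv ?_
    refine ((((hasDerivAt_id t).const_mul ω).const_add φ0).sub
      ((hu t).cos.const_mul (2 * g * sin α / (3 * Ω ^ 2 * R)))).congr_deriv ?_
    field_simp
    ring
  have hdy : deriv y = fun t =>
      (ω * R + 2 * g * sin α / (3 * Ω) * sin (Ω * t + θ0)) * cos (Ω * t + θ0) := by
    rw [funext hy]
    funext t
    refine HasDerivAt.deriv ?_
    refine (((((hu t).sin.const_mul (g * sin α / (3 * Ω ^ 2))).const_add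
      (ω * R / Ω)).mul (hu t).sin).const_add y0).congr_deriv ?_
    field_simp
    ring
  have hdy_diff : Differentiable ℝ (deriv y) := by
    rw [hdy]
    fun_prop
  -- The second equation integrates to a linear momentum law.
  have hconst : ∀ s t, lam2 s + m * deriv y s - m * g * sin α * s
      = lam2 t + m * deriv y t - m * g * sin α * t := by
    have hderiv : ∀ t, HasDerivAt
        (fun t => lam2 t + m * deriv y t - m * g * sin α * t) 0 t := by
      intro t
      refine (((hlam2 t).hasDerivAt.add ((hdy_diff t).hasDerivAt.const_mul m)).sub
        ((hasDerivAt_id t).const_mul (m * g * sin α))).congr_deriv ?_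
      linarith [hyEq t]
    exact is_const_of_deriv_eq_zero (fun t => (hderiv t).differentiableAt)
      fun t => (hderiv t).deriv
  have hA : 2 * g * sin α / (3 * Ω * R) ≠ 0 := by positivity
  obtain ⟨u, hcos, hroll⟩ :
      ∃ u, cos u = 0 ∧ ω + 2 * g * sin α / (3 * Ω * R) * sin u ≠ 0 := by
    by_cases h : ω + 2 * g * sin α / (3 * Ω * R) = 0
    · refine ⟨-(π / 2), by simp, fun h' => hA ?_⟩
      rw [sin_neg, sin_pi_div_two] at h'
      linarith
    · exact ⟨π / 2, cos_pi_div_two, by simpa using h⟩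
  -- Where the coin is rolling with `cos θ = 0`, the fourth equation forces `λ₂ = 0`.
  have hzero : ∀ t, cos (Ω * t + θ0) = 0 →
      ω + 2 * g * sin α / (3 * Ω * R) * sin (Ω * t + θ0) ≠ 0 →
      lam2 t + m * deriv y t = 0 := by
    intro t hc hr
    have hs : sin (Ω * t + θ0) ≠ 0 := fun h => by
      simpa [h, hc] using sin_sq_add_cos_sq (Ω * t + θ0)
    have h := hθEq t
    rw [hdθ, deriv_const, hdφ, hθ, hc] at h
    have : lam2 t = 0 := by simpa [hR.ne', hr, hs] using h
    simp [this, hdy, hc]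
  have hu0 : Ω * ((u - θ0) / Ω) + θ0 = u := by field_simp; ring
  have hu1 : Ω * ((u + 2 * π - θ0) / Ω) + θ0 = u + 2 * π := by field_simp; ring
  have h0 := hzero ((u - θ0) / Ω) (by rwa [hu0]) (by rwa [hu0])
  have h1 := hzero ((u + 2 * π - θ0) / Ω) (by rwa [hu1, cos_add_two_pi])
    (by rwa [hu1, sin_add_two_pi])
  have h := hconst ((u - θ0) / Ω) ((u + 2 * π - θ0) / Ω)
  rw [h0, h1] at h
  have hgap : m * g * sin α * (2 * π / Ω) = 0 := by
    linear_combination h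
  have : m * g * sin α * (2 * π / Ω) ≠ 0 := by positivity
  exact this hgap
end

section
/- (Main theorem, abstract form: complete inequivalence.) Let m, R, g > 0 and 0 < α < π/2. Suppose twice-differentiable functions x, y, φ, θ : ℝ → ℝ together with functions λ1, λ2 : ℝ → ℝ satisfy both rolling constraints and all four nonholonomic equations of motion, and suppose θ'(0) ≠ 0 (the nontrivial case). Then there exist NO differentiable functions μ1, μ2 : ℝ → ℝ such that x, y, φ, θ together with μ1, μ2 satisfy all four vakonomic equations of motion for all t; that is, the sets of nontrivial nonholonomic motions and of vakonomic motions of the rolling coin on the inclined plane are disjoint. -/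
open Real

/-- Main theorem (abstract form, complete inequivalence): for the rolling
coin on an inclined plane with `0 < α < π/2`, any nontrivial (`θ'(0) ≠ 0`)
nonholonomic motion — i.e. a solution of the rolling constraints and the
four nonholonomic equations of motion — cannot satisfy the four vakonomic
equations of motion for any differentiable multipliers `μ₁, μ₂`: the sets of
nontrivial nonholonomic motions and of vakonomic motions are disjoint. -/
theorem rolling_coin_complete_inequivalence
    (m R g α : ℝ) (hm : 0 < m) (hR : 0 < R) (hg : 0 < g)
    (hα1 : 0 < α) (hα2 : α < π / 2)
    (x y φ θ : ℝ → ℝ) (lam1 lam2 : ℝ → ℝ)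
    (hx : Differentiable ℝ x) (hx' : Differentiable ℝ (deriv x))
    (hy : Differentiable ℝ y) (hy' : Differentiable ℝ (deriv y))
    (hφ : Differentiable ℝ φ) (hφ' : Differentiable ℝ (deriv φ))
    (hθ : Differentiable ℝ θ) (hθ' : Differentiable ℝ (deriv θ))
    (hcon1 : ∀ t, deriv x t = R * deriv φ t * Real.sin (θ t))
    (hcon2 : ∀ t, deriv y t = R * deriv φ t * Real.cos (θ t))
    (heq1 : ∀ t, m * deriv (deriv x) t = lam1 t)
    (heq2 : ∀ t, m * deriv (deriv y) t = m * g * Real.sin α + lam2 t)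
    (heq3 : ∀ t, m * R ^ 2 / 2 * deriv (deriv φ) t
      = -(lam1 t) * R * Real.sin (θ t) - lam2 t * R * Real.cos (θ t))
    (heq4 : ∀ t, m * R ^ 2 / 4 * deriv (deriv θ) t = 0)
    (hnontrivial : deriv θ 0 ≠ 0) :
    ¬ ∃ mu1 mu2 : ℝ → ℝ,
      Differentiable ℝ mu1 ∧ Differentiable ℝ mu2 ∧
      (∀ t, m * deriv (deriv x) t = -(deriv mu1 t)) ∧
      (∀ t, m * deriv (deriv y) t = m * g * Real.sin α - deriv mu2 t) ∧
      (∀ t, m * R ^ 2 / 2 * deriv (deriv φ) t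
        = mu1 t * R * deriv θ t * Real.cos (θ t)
          - mu2 t * R * deriv θ t * Real.sin (θ t)
          + deriv mu1 t * R * Real.sin (θ t)
          + deriv mu2 t * R * Real.cos (θ t)) ∧
      (∀ t, m * R ^ 2 / 4 * deriv (deriv θ) t
        = -(mu1 t) * R * deriv φ t * Real.cos (θ t)
          + mu2 t * R * deriv φ t * Real.sin (θ t)) := by
  rintro ⟨mu1, mu2, hmu1, hmu2, hv1, hv2, hv3, -⟩
  have hm0 : m ≠ 0 := hm.ne'
  have hR0 : R ≠ 0 := hR.ne'
  have hsinα : 0 < Real.sin α := Real.sin_pos_of_pos_of_lt_pi hα1 (by linarith [Real.pi_pos])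
  have hθ'' : ∀ t, deriv (deriv θ) t = 0 := fun t =>
    (mul_eq_zero.mp (heq4 t)).resolve_left (by positivity)
  obtain ⟨ω, hω⟩ : ∃ ω, ∀ t, deriv θ t = ω :=
    ⟨deriv θ 0, fun t => is_const_of_deriv_eq_zero hθ' hθ'' t 0⟩
  have hω0 : ω ≠ 0 := hω 0 ▸ hnontrivial
  have hdθ : ∀ t, HasDerivAt θ ω t := fun t => hω t ▸ (hθ t).hasDerivAt
  have hds : ∀ t, HasDerivAt (fun t => Real.sin (θ t)) (Real.cos (θ t) * ω) t :=
    fun t => (hdθ t).sin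
  have hdc : ∀ t, HasDerivAt (fun t => Real.cos (θ t)) (-Real.sin (θ t) * ω) t :=
    fun t => (hdθ t).cos
  have hx'' : ∀ t, deriv (deriv x) t
      = R * deriv (deriv φ) t * Real.sin (θ t) + R * deriv φ t * (Real.cos (θ t) * ω) := by
    intro t
    rw [funext hcon1]
    exact (((hφ' t).hasDerivAt.const_mul R).mul (hds t)).deriv
  have hy'' : ∀ t, deriv (deriv y) t
      = R * deriv (deriv φ) t * Real.cos (θ t) + R * deriv φ t * (-Real.sin (θ t) * ω) := by
    intro t
    rw [funext hcon2]
    exact (((hφ' t).hasDerivAt.const_mul R).mul (hdc t)).deriv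
  have hmu1' : ∀ t, deriv mu1 t = -lam1 t := fun t => by linarith [hv1 t, heq1 t]
  have hmu2' : ∀ t, deriv mu2 t = -lam2 t := fun t => by linarith [hv2 t, heq2 t]
  -- The component of the multiplier transverse to the rolling direction vanishes.
  have hP : ∀ t, mu1 t * Real.cos (θ t) - mu2 t * Real.sin (θ t) = 0 := by
    intro t
    have h := hv3 t
    rw [heq3 t, hmu1' t, hmu2' t, hω t] at h
    have h' : R * ω * (mu1 t * Real.cos (θ t) - mu2 t * Real.sin (θ t)) = 0 := by linarith
    exact (mul_eq_zero.mp h').resolve_left (mul_ne_zero hR0 hω0)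
  have hP' : ∀ t, deriv mu1 t * Real.cos (θ t) + mu1 t * (-Real.sin (θ t) * ω)
      - (deriv mu2 t * Real.sin (θ t) + mu2 t * (Real.cos (θ t) * ω)) = 0 := by
    intro t
    have h : HasDerivAt (fun t => mu1 t * Real.cos (θ t) - mu2 t * Real.sin (θ t)) _ t :=
      ((hmu1 t).hasDerivAt.mul (hdc t)).sub ((hmu2 t).hasDerivAt.mul (hds t))
    rw [funext hP] at h
    exact h.unique (hasDerivAt_const t 0)
  -- The component along the rolling direction is thereby determined.
  have hQ : ∀ t, ω * (mu1 t * Real.sin (θ t) + mu2 t * Real.cos (θ t))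
      = -(m * R * ω) * deriv φ t - m * g * Real.sin α * Real.sin (θ t) := by
    intro t
    have h := hP' t
    have h1 := hv1 t
    have h2 := hv2 t
    rw [hx'' t] at h1
    rw [hy'' t] at h2
    linear_combination -h + Real.cos (θ t) * h1 - Real.sin (θ t) * h2
      - m * R * deriv φ t * ω * Real.sin_sq_add_cos_sq (θ t)
  have hQ' : ∀ t, ω * (deriv mu1 t * Real.sin (θ t) + mu1 t * (Real.cos (θ t) * ω)
      + (deriv mu2 t * Real.cos (θ t) + mu2 t * (-Real.sin (θ t) * ω)))
      = -(m * R * ω) * deriv (deriv φ) t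
        - m * g * Real.sin α * (Real.cos (θ t) * ω) := by
    intro t
    have h : HasDerivAt
        (fun t => ω * (mu1 t * Real.sin (θ t) + mu2 t * Real.cos (θ t))) _ t :=
      (((hmu1 t).hasDerivAt.mul (hds t)).add ((hmu2 t).hasDerivAt.mul (hdc t))).const_mul ω
    rw [funext hQ] at h
    exact h.unique (((hφ' t).hasDerivAt.const_mul _).sub ((hds t).const_mul _))
  have hcos : ∀ t, Real.cos (θ t) = 0 := by
    intro t
    have e3 := heq3 t
    have e1 := heq1 t
    have e2 := heq2 t
    rw [hx'' t] at e1
    rw [hy'' t] at e2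
    have hroll : 3 * R * deriv (deriv φ) t = 2 * g * Real.sin α * Real.cos (θ t) := by
      apply mul_left_cancel₀ (mul_ne_zero hm0 hR0)
      linear_combination 2 * e3 + 2 * R * Real.sin (θ t) * e1 + 2 * R * Real.cos (θ t) * e2
        - 2 * m * R ^ 2 * deriv (deriv φ) t * Real.sin_sq_add_cos_sq (θ t)
    have hvak : 3 * R * deriv (deriv φ) t = -(2 * g * Real.sin α * Real.cos (θ t)) := by
      have h := hQ' t
      rw [hmu1' t, hmu2' t] at h
      apply mul_left_cancel₀ (mul_ne_zero (mul_ne_zero hm0 hR0) hω0)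
      linear_combination 2 * R * h + 2 * ω * e3 - 2 * R * ω ^ 2 * hP t
    have h : 4 * g * Real.sin α * Real.cos (θ t) = 0 := by linarith
    exact (mul_eq_zero.mp h).resolve_left (by positivity)
  have hsin : Real.sin (θ 0) = 0 := by
    have h := hdc 0
    rw [funext hcos] at h
    have h' := h.unique (hasDerivAt_const 0 0)
    simpa [hω0] using h'
  have h := Real.sin_sq_add_cos_sq (θ 0)
  simp [hsin, hcos 0] at h
end

section
/- (Horizontal plane: vakonomic realization of nonholonomic motion.) Let m, R > 0 and α = 0 (so sin α = 0). Suppose x, y, φ, θ : ℝ → ℝ are twice differentiable with θ(t) = Ω t + θ0 and φ'(t) = ω constant (so φ''(t) = 0), and suppose the rolling constraints x'(t) = R φ'(t) sin θ(t) and y'(t) = R φ'(t) cos θ(t) hold for all t. Then the functions λ1(t) := −m x'(t) and λ2(t) := −m y'(t) are differentiable and, together with x, y, φ, θ, satisfy all four vakonomic equations of motion; hence the nonholonomic motion of a coin rolling on a horizontal plane is also a vakonomic motion. -/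
open Real

/-- Horizontal plane (`α = 0`): for a coin rolling with `θ = Ω t + θ0` and
constant `φ' = ω`, subject to the rolling constraints, the choices
`λ₁ = −m x'` and `λ₂ = −m y'` are differentiable and satisfy all four
vakonomic equations of motion; hence the nonholonomic motion of a coin on a
horizontal plane is also a vakonomic motion. -/
theorem rolling_coin_horizontal_vakonomic_realization
    (m R g α Ω θ0 ω : ℝ) (hm : 0 < m) (hR : 0 < R) (hg : 0 < g)
    (hα : α = 0)
    (x y φ θ : ℝ → ℝ)
    (hx : Differentiable ℝ x) (hx' : Differentiable ℝ (deriv x))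
    (hy : Differentiable ℝ y) (hy' : Differentiable ℝ (deriv y))
    (hφ : Differentiable ℝ φ) (hφ' : Differentiable ℝ (deriv φ))
    (hθdiff : Differentiable ℝ θ) (hθ'diff : Differentiable ℝ (deriv θ))
    (hθ : ∀ t, θ t = Ω * t + θ0)
    (hω : ∀ t, deriv φ t = ω)
    (hcon1 : ∀ t, deriv x t = R * deriv φ t * Real.sin (θ t))
    (hcon2 : ∀ t, deriv y t = R * deriv φ t * Real.cos (θ t)) :
    Differentiable ℝ (fun t => -m * deriv x t) ∧
    Differentiable ℝ (fun t => -m * deriv y t) ∧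
    (∀ t, m * deriv (deriv x) t = -(deriv (fun s => -m * deriv x s) t)) ∧
    (∀ t, m * deriv (deriv y) t
      = m * g * Real.sin α - deriv (fun s => -m * deriv y s) t) ∧
    (∀ t, m * R ^ 2 / 2 * deriv (deriv φ) t
      = (-m * deriv x t) * R * deriv θ t * Real.cos (θ t)
        - (-m * deriv y t) * R * deriv θ t * Real.sin (θ t)
        + deriv (fun s => -m * deriv x s) t * R * Real.sin (θ t)
        + deriv (fun s => -m * deriv y s) t * R * Real.cos (θ t)) ∧
    (∀ t, m * R ^ 2 / 4 * deriv (deriv θ) t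
      = -(-m * deriv x t) * R * deriv φ t * Real.cos (θ t)
        + (-m * deriv y t) * R * deriv φ t * Real.sin (θ t)) := by
  have hdθ : ∀ t, HasDerivAt θ Ω t := fun t => by
    rw [funext hθ]
    simpa using ((hasDerivAt_id t).const_mul Ω).add_const θ0
  have hdx : ∀ t, deriv (deriv x) t = R * ω * (Real.cos (θ t) * Ω) := fun t => by
    have hx_eq : deriv x = fun s => R * ω * Real.sin (θ s) :=
      funext fun s => by rw [hcon1, hω]
    rw [hx_eq]
    exact ((hdθ t).sin.const_mul (R * ω)).deriv
  have hdy : ∀ t, deriv (deriv y) t = R * ω * (-Real.sin (θ t) * Ω) := fun t => by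
    have hy_eq : deriv y = fun s => R * ω * Real.cos (θ s) :=
      funext fun s => by rw [hcon2, hω]
    rw [hy_eq]
    exact ((hdθ t).cos.const_mul (R * ω)).deriv
  have hddφ : ∀ t, deriv (deriv φ) t = 0 := fun t => by
    rw [funext hω, deriv_const]
  have hddθ : ∀ t, deriv (deriv θ) t = 0 := fun t => by
    rw [funext fun s => (hdθ s).deriv, deriv_const]
  have hl1 : ∀ t, deriv (fun s => -m * deriv x s) t = -m * deriv (deriv x) t :=
    fun t => ((hx' t).hasDerivAt.const_mul (-m)).deriv
  have hl2 : ∀ t, deriv (fun s => -m * deriv y s) t = -m * deriv (deriv y) t :=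
    fun t => ((hy' t).hasDerivAt.const_mul (-m)).deriv
  refine ⟨hx'.const_mul (-m), hy'.const_mul (-m), fun t => ?_, fun t => ?_, fun t => ?_,
    fun t => ?_⟩
  · rw [hl1]; ring
  · rw [hl2, hα, Real.sin_zero]; ring
  · rw [hl1, hl2, hdx, hdy, hddφ, hcon1, hcon2, hω, (hdθ t).deriv]; ring
  · rw [hddθ, hcon1, hcon2, hω]; ring
end

section
/- Let n be a natural number and let f : ℝⁿ × ℝ → ℝ be twice continuously differentiable. Define g : ℝⁿ × ℝⁿ × ℝ → ℝ by g(q, v, t) = Σⱼ (∂f/∂qⱼ)(q, t) vⱼ + (∂f/∂t)(q, t), i.e., g is the total time derivative of the holonomic constraint function f expressed as a function of positions and velocities. Then for every continuously differentiable curve q : ℝ → ℝⁿ, every index k, and every t: d/dt [ (∂g/∂vₖ)(q(t), q'(t), t) ] = (∂g/∂qₖ)(q(t), q'(t), t). -/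
open Real

/-- A continuous linear functional at `(v, 1)`, expanded in the coordinates of `v`. -/
lemma ContinuousLinearMap.apply_prodMk_one_eq_sum {n : ℕ} (L : (Fin n → ℝ) × ℝ →L[ℝ] ℝ)
    (v : Fin n → ℝ) :
    L (v, 1) = (∑ j : Fin n, v j * L (Pi.single j 1, 0)) + L (0, 1) := by
  have h : ((v, 1) : (Fin n → ℝ) × ℝ)
      = (∑ j : Fin n, v j • ((Pi.single j 1, 0) : (Fin n → ℝ) × ℝ)) + (0, 1) := by
    ext i
    · simp [Prod.fst_sum, Finset.sum_apply, Pi.single_apply]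
    · simp [Prod.snd_sum]
  rw [h]
  simp only [map_add, map_sum, map_smul, smul_eq_mul]

/-- If `g(q, v, t) = Σⱼ (∂F/∂qⱼ)(q,t) vⱼ + (∂F/∂t)(q,t)` is the total time
derivative of a twice continuously differentiable holonomic constraint
function `F`, then along any continuously differentiable curve `q` one has
`d/dt (∂g/∂vₖ)(q(t), q'(t), t) = (∂g/∂qₖ)(q(t), q'(t), t)` for every `k`;
this identity reduces the vakonomic equations of motion to the nonholonomic
ones in the holonomic case. -/
theorem holonomic_total_derivative_transpositional_identity
    (n : ℕ) (F : (Fin n → ℝ) × ℝ → ℝ) (hF : ContDiff ℝ 2 F)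
    (g : (Fin n → ℝ) → (Fin n → ℝ) → ℝ → ℝ)
    (hg : ∀ (q v : Fin n → ℝ) (t : ℝ), g q v t
      = (∑ j : Fin n, v j * fderiv ℝ F (q, t) (Pi.single j 1, 0))
        + fderiv ℝ F (q, t) (0, 1))
    (q : ℝ → Fin n → ℝ) (hq : ContDiff ℝ 1 q) (k : Fin n) (t : ℝ) :
    deriv (fun s =>
        deriv (fun a => g (q s) (Function.update (deriv q s) k a) s)
          (deriv q s k)) t
      = deriv (fun a => g (Function.update (q t) k a) (deriv q t) t)
          (q t k) := by
  have hg' : ∀ (x v : Fin n → ℝ) (s : ℝ), g x v s = fderiv ℝ F (x, s) (v, 1) := fun x v s ↦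
    (hg x v s).trans (ContinuousLinearMap.apply_prodMk_one_eq_sum _ v).symm
  have hF' : DifferentiableAt ℝ (fderiv ℝ F) (q t, t) :=
    (hF.fderiv_right (m := 1) (by norm_num)).differentiable one_ne_zero _
  have hsymm : IsSymmSndFDerivAt ℝ F (q t, t) :=
    hF.contDiffAt.isSymmSndFDerivAt (by simp)
  have hv : ∀ s, deriv (fun a => g (q s) (Function.update (deriv q s) k a) s) (deriv q s k)
      = fderiv ℝ F (q s, s) (Pi.single k 1, 0) := fun s ↦ by
    simp only [hg']
    exact ((fderiv ℝ F (q s, s)).hasFDerivAt.comp_hasDerivAt _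
      ((hasDerivAt_update (deriv q s) k _).prodMk (hasDerivAt_const _ (1 : ℝ)))).deriv
  have hl : HasDerivAt (fun s => fderiv ℝ F (q s, s) (Pi.single k 1, 0))
      (fderiv ℝ (fderiv ℝ F) (q t, t) (deriv q t, 1) (Pi.single k 1, 0)) t := by
    have hc : HasDerivAt (fun s => (q s, s)) (deriv q t, (1 : ℝ)) t :=
      (hq.differentiable one_ne_zero t).hasDerivAt.prodMk (hasDerivAt_id t)
    simpa using (hF'.hasFDerivAt.comp_hasDerivAt_of_eq t hc rfl).clm_apply
      (hasDerivAt_const t ((Pi.single k 1, 0) : (Fin n → ℝ) × ℝ))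
  have hr : HasDerivAt (fun a => fderiv ℝ F (Function.update (q t) k a, t) (deriv q t, 1))
      (fderiv ℝ (fderiv ℝ F) (q t, t) (Pi.single k 1, 0) (deriv q t, 1)) (q t k) := by
    have hc : HasDerivAt (fun a => (Function.update (q t) k a, t))
        (Pi.single k 1, (0 : ℝ)) (q t k) :=
      (hasDerivAt_update (q t) k _).prodMk (hasDerivAt_const _ t)
    simpa using (hF'.hasFDerivAt.comp_hasDerivAt_of_eq (q t k) hc (by simp)).clm_apply
      (hasDerivAt_const (q t k) ((deriv q t, 1) : (Fin n → ℝ) × ℝ))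
  simp only [hv]
  simp only [hg']
  rw [hl.deriv, hr.deriv, hsymm.eq]
end
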